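/- arXiv:2107.08647 — 3 statements merged into one kernel-verified Lean document; each statement's English description precedes it below -/
import Mathlib

section
/- Let m ∈ ℕ. Suppose a ∈ ℝ is such that for every u ∈ H¹(𝔹²) satisfying ∫_{S¹} e^{u} p dμ_{S¹} = 0 for all p ∈ P̊_m, one has a ∫_{𝔹²} |∇u|² dx ≥ log( (1/(2π)) ∫_{S¹} e^{u - ū} dμ_{S¹} ), where ū = (1/(2π)) ∫_{S¹} u dμ_{S¹}. Then a ≥ 1/(4π(m+1)). -/
open MeasureTheory Metric Filter
open scoped ENNReal RealInnerProductSpace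

noncomputable section

abbrev E (n : ℕ) : Type := EuclideanSpace ℝ (Fin n)

/-- The standard surface measure on the unit sphere `S^{n-1}` (arclength measure on `S¹`
when `n = 2`), as a Borel measure on `ℝⁿ`. -/
def sphMeasure (n : ℕ) : Measure (E n) :=
  Measure.map Subtype.val ((volume : Measure (E n)).toSphere)

/-- `P̊_m` : polynomials of degree at most `m` with zero mean on the sphere. -/
def P0 (n m : ℕ) : Set (MvPolynomial (Fin n) ℝ) :=
  {p | p.totalDegree ≤ m ∧ ∫ x, MvPolynomial.eval (fun i => x i) p ∂(sphMeasure n) = 0}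


open scoped Pointwise

lemma vol_ball2 : (volume : Measure (E 2)).real (ball 0 1) = Real.pi := by
  rw [measureReal_def, EuclideanSpace.volume_ball_fin_two]
  simp [Real.pi_pos.le]

/-- Identification of the plane with `ℂ`. -/
def LL : E 2 ≃ₗᵢ[ℝ] ℂ := Complex.orthonormalBasisOneI.repr.symm

lemma LL_apply (x : E 2) : LL x = x 0 + x 1 * Complex.I := by
  simp [LL]

lemma sph_apply {s : Set (E 2)} (hs : MeasurableSet s) :
    sphMeasure 2 s = 2 * volume (Set.Ioo (0 : ℝ) 1 • (s ∩ sphere 0 1)) := by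
  rw [sphMeasure, Measure.map_apply measurable_subtype_coe hs,
    Measure.toSphere_apply' _ (measurable_subtype_coe hs)]
  congr 2
  · simp
  · rw [Subtype.image_preimage_coe, Set.inter_comm]

lemma sph_map (R : E 2 ≃ₗᵢ[ℝ] E 2) : MeasurePreserving R (sphMeasure 2) (sphMeasure 2) := by
  refine ⟨R.continuous.measurable, ?_⟩
  ext s hs
  rw [Measure.map_apply R.continuous.measurable hs, sph_apply hs,
    sph_apply (R.continuous.measurable hs)]
  congr 1
  have hR : MeasurePreserving R.toMeasurableEquiv (volume : Measure (E 2)) volume :=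
    R.measurePreserving
  rw [← hR.measure_preimage_equiv (Set.Ioo (0 : ℝ) 1 • (s ∩ sphere 0 1))]
  congr 1
  ext x
  simp only [Set.mem_smul, Set.mem_preimage, Set.mem_inter_iff]
  constructor
  · rintro ⟨t, ht, y, ⟨hy, hy'⟩, rfl⟩
    exact ⟨t, ht, R y, ⟨hy, by simpa using hy'⟩, (R.map_smul t y).symm⟩
  · rintro ⟨t, ht, y, ⟨hy, hy'⟩, hx⟩
    refine ⟨t, ht, R.symm y, ⟨by simpa using hy, by simpa using hy'⟩, ?_⟩
    apply R.injective
    rw [R.map_smul, R.apply_symm_apply]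
    exact hx

instance : IsFiniteMeasure (sphMeasure 2) := by
  unfold sphMeasure; infer_instance

lemma sph_real : (sphMeasure 2).real Set.univ = 2 * Real.pi := by
  rw [sphMeasure, map_measureReal_apply measurable_subtype_coe MeasurableSet.univ]
  simp [vol_ball2]

lemma sph_ae : ∀ᵐ x ∂(sphMeasure 2), ‖x‖ = 1 := by
  have : MeasurableSet {x : E 2 | ‖x‖ = 1} := (isClosed_eq continuous_norm continuous_const).measurableSet
  rw [sphMeasure, ae_map_iff measurable_subtype_coe.aemeasurable this]
  filter_upwards with x
  simpa using x.2

lemma sph_int {F : Type*} [NormedAddCommGroup F] {g : E 2 → F} (hg : Continuous g) :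
    Integrable g (sphMeasure 2) := by
  have h1 : (sphMeasure 2).restrict (sphere 0 1) = sphMeasure 2 := by
    apply Measure.restrict_eq_self_of_ae_mem
    filter_upwards [sph_ae] with x hx
    simpa using hx
  rw [← h1]
  exact hg.continuousOn.integrableOn_compact (isCompact_sphere 0 1)

lemma sph_rot {F : Type*} [NormedAddCommGroup F] [NormedSpace ℝ F] (g : ℂ → F) (w : ℂ)
    (hw : ‖w‖ = 1) :
    ∫ x, g (w * LL x) ∂(sphMeasure 2) = ∫ x, g (LL x) ∂(sphMeasure 2) := by
  let c : Circle := ⟨w, by simpa [Submonoid.unitSphere] using hw⟩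
  let R : E 2 ≃ₗᵢ[ℝ] E 2 := (LL.trans (rotation c)).trans LL.symm
  have := (sph_map R).integral_comp R.toHomeomorph.measurableEmbedding (fun x => g (LL x))
  rw [← this]
  refine integral_congr_ae (Filter.Eventually.of_forall fun x => ?_)
  have hR : LL (R x) = w * LL x := by
    change LL (LL.symm (rotation c (LL x))) = _
    rw [LL.apply_symm_apply, rotation_apply]
  simp only [hR]

/-- spaces of polynomials in `z`, `conj z` -/
def GG (k : ℕ) : Submodule ℂ (ℂ → ℂ) :=
  Submodule.span ℂ {f | ∃ a b : ℕ, a + b ≤ k ∧ f = fun z => z ^ a * (starRingEnd ℂ z) ^ b}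

lemma GG_mul (k : ℕ) (f : ℂ → ℂ) (hf : f ∈ GG k) :
    (fun z => z * f z) ∈ GG (k + 1) ∧ (fun z => starRingEnd ℂ z * f z) ∈ GG (k + 1) := by
  induction hf using Submodule.span_induction with
  | mem f hf =>
    obtain ⟨a, b, hab, rfl⟩ := hf
    constructor
    · exact Submodule.subset_span ⟨a + 1, b, by omega, by ext z; ring⟩
    · exact Submodule.subset_span ⟨a, b + 1, by omega, by ext z; ring⟩
  | zero =>
    constructor
    · convert (GG (k + 1)).zero_mem using 1; ext z; simp
    · convert (GG (k + 1)).zero_mem using 1; ext z; simp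
  | add f g _ _ hf hg =>
    constructor
    · convert (GG (k + 1)).add_mem hf.1 hg.1 using 1; ext z; simp; ring
    · convert (GG (k + 1)).add_mem hf.2 hg.2 using 1; ext z; simp; ring
  | smul c f _ hf =>
    constructor
    · convert (GG (k + 1)).smul_mem c hf.1 using 1; ext z; simp; ring
    · convert (GG (k + 1)).smul_mem c hf.2 using 1; ext z; simp; ring

lemma GG_mono {k l : ℕ} (h : k ≤ l) : GG k ≤ GG l := by
  apply Submodule.span_mono
  rintro f ⟨a, b, hab, rfl⟩
  exact ⟨a, b, by omega, rfl⟩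

lemma GG_re (k : ℕ) (f : ℂ → ℂ) (hf : f ∈ GG k) : (fun z => (z.re : ℂ) * f z) ∈ GG (k + 1) := by
  have := (GG_mul k f hf)
  convert (GG (k + 1)).smul_mem (1 / 2 : ℂ) ((GG (k + 1)).add_mem this.1 this.2) using 1
  ext z
  simp only [Pi.smul_apply, Pi.add_apply, smul_eq_mul, Complex.re_eq_add_conj]
  ring

lemma GG_im (k : ℕ) (f : ℂ → ℂ) (hf : f ∈ GG k) : (fun z => (z.im : ℂ) * f z) ∈ GG (k + 1) := by
  have := (GG_mul k f hf)
  convert (GG (k + 1)).smul_mem (1 / (2 * Complex.I) : ℂ) ((GG (k + 1)).sub_mem this.1 this.2) using 1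
  ext z
  simp only [Pi.smul_apply, Pi.sub_apply, smul_eq_mul, Complex.im_eq_sub_conj]
  ring

lemma GG_monom (i j : ℕ) : (fun z : ℂ => (z.re : ℂ) ^ i * (z.im : ℂ) ^ j) ∈ GG (i + j) := by
  induction i with
  | zero =>
    induction j with
    | zero => exact Submodule.subset_span ⟨0, 0, by omega, by ext z; simp⟩
    | succ j ih =>
      have := GG_im _ _ ih
      rw [show 0 + j + 1 = 0 + (j + 1) by ring] at this
      convert this using 1
      funext z; ring
  | succ i ih =>
    have := GG_re _ _ ih
    rw [show i + j + 1 = i + 1 + j by ring] at this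
    convert this using 1
    ext z; ring

lemma GG_poly (m : ℕ) (p : MvPolynomial (Fin 2) ℝ) (hp : p.totalDegree ≤ m) :
    ∃ f ∈ GG m, ∀ x : E 2, ((MvPolynomial.eval (fun i => x i) p : ℝ) : ℂ) = f (LL x) := by
  refine ⟨∑ d ∈ p.support, ((p.coeff d : ℝ) : ℂ) •
    (fun z : ℂ => (z.re : ℂ) ^ (d 0) * (z.im : ℂ) ^ (d 1)), ?_, ?_⟩
  · refine Submodule.sum_mem _ fun d hd => Submodule.smul_mem _ _ ?_
    refine GG_mono ?_ (GG_monom _ _)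
    have := MvPolynomial.le_totalDegree hd
    rw [Finsupp.sum_fintype _ _ (by simp)] at this
    simp at this
    omega
  · intro x
    rw [MvPolynomial.eval_eq']
    simp [LL_apply, Finset.sum_apply]

lemma GG_avg (m : ℕ) (w : ℂ) (hw : IsPrimitiveRoot w (m + 1)) (f : ℂ → ℂ) (hf : f ∈ GG m) :
    ∃ c : ℂ, ∀ z : ℂ, ‖z‖ = 1 → ∑ k ∈ Finset.range (m + 1), f (w ^ k * z) = c := by
  have hw1 : ‖w‖ = 1 := hw.norm'_eq_one (by omega)
  induction hf using Submodule.span_induction with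
  | mem f hf =>
    obtain ⟨a, b, hab, rfl⟩ := hf
    have hcw : starRingEnd ℂ w = w⁻¹ := by
      rw [Complex.inv_def, Complex.normSq_eq_norm_sq, hw1]; simp
    have hw0 : w ≠ 0 := by intro h0; simp [h0] at hw1
    by_cases h : a = b
    · subst h
      refine ⟨(m + 1 : ℕ), fun z hz => ?_⟩
      have : ∀ k ∈ Finset.range (m + 1),
          (w ^ k * z) ^ a * (starRingEnd ℂ (w ^ k * z)) ^ a = 1 := by
        intro k _
        rw [← mul_pow, Complex.mul_conj, Complex.normSq_eq_norm_sq]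
        simp [hw1, hz]
      rw [Finset.sum_congr rfl this]
      simp
    · refine ⟨0, fun z hz => ?_⟩
      have hne : w ^ a * (w⁻¹) ^ b ≠ 1 := by
        intro h1
        apply h
        apply hw.pow_inj (by omega) (by omega)
        rw [inv_pow] at h1
        field_simp at h1
        exact h1
      have h2 : ∑ k ∈ Finset.range (m + 1), (w ^ a * (w⁻¹) ^ b) ^ k = 0 := by
        rw [geom_sum_eq hne]
        have : (w ^ a * (w⁻¹) ^ b) ^ (m + 1) = 1 := by
          rw [mul_pow, ← pow_mul, ← pow_mul, mul_comm a, mul_comm b, pow_mul, pow_mul, inv_pow,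
            hw.pow_eq_one]
          simp
        rw [this]; simp
      have : ∀ k ∈ Finset.range (m + 1),
          (w ^ k * z) ^ a * (starRingEnd ℂ (w ^ k * z)) ^ b =
            (w ^ a * (w⁻¹) ^ b) ^ k * (z ^ a * (starRingEnd ℂ z) ^ b) := by
        intro k _
        rw [map_mul, map_pow, hcw]
        ring
      rw [Finset.sum_congr rfl this, ← Finset.sum_mul, h2, zero_mul]
  | zero => exact ⟨0, by simp⟩
  | add f g _ _ hf hg =>
    obtain ⟨c, hc⟩ := hf
    obtain ⟨d, hd⟩ := hg
    refine ⟨c + d, fun z hz => ?_⟩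
    simp [Finset.sum_add_distrib, hc z hz, hd z hz]
  | smul t f _ hf =>
    obtain ⟨c, hc⟩ := hf
    refine ⟨t * c, fun z hz => ?_⟩
    simp [← Finset.mul_sum, hc z hz]

lemma moments (m : ℕ) (v : ℂ → ℝ) (hv : Continuous v)
    (hinv : ∀ w z : ℂ, w ^ (m + 1) = 1 → v (w * z) = v z) (p : MvPolynomial (Fin 2) ℝ)
    (hp : p ∈ P0 2 m) :
    ∫ x, v (LL x) * MvPolynomial.eval (fun i => x i) p ∂(sphMeasure 2) = 0 := by
  obtain ⟨hd, h0⟩ := hp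
  obtain ⟨f, hf, hfp⟩ := GG_poly m p hd
  let w : ℂ := Complex.exp (2 * Real.pi * Complex.I / ((m + 1 : ℕ) : ℂ))
  have hw : IsPrimitiveRoot w (m + 1) := Complex.isPrimitiveRoot_exp (m + 1) (by omega)
  have hw1 : ‖w‖ = 1 := hw.norm'_eq_one (by omega)
  obtain ⟨c, hc⟩ := GG_avg m w hw f hf
  have hq : Continuous fun x : E 2 => MvPolynomial.eval (fun i => x i) p :=
    (MvPolynomial.continuous_eval p).comp (by fun_prop)
  have hfc : Continuous fun x : E 2 => f (LL x) := by
    simp_rw [← hfp]; fun_prop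
  have hfc' : Continuous f := by
    have := hfc.comp LL.symm.continuous
    simpa [Function.comp_def] using this
  have key : ∀ v : ℂ → ℝ, Continuous v → (∀ w z : ℂ, w ^ (m + 1) = 1 → v (w * z) = v z) →
      (m + 1 : ℂ) * ∫ x, (v (LL x) : ℂ) * f (LL x) ∂(sphMeasure 2)
        = c * ∫ x, (v (LL x) : ℂ) ∂(sphMeasure 2) := by
    intro v hv hinv
    have h1 : ∀ k ∈ Finset.range (m + 1),
        ∫ x, (v (LL x) : ℂ) * f (w ^ k * LL x) ∂(sphMeasure 2)
          = ∫ x, (v (LL x) : ℂ) * f (LL x) ∂(sphMeasure 2) := by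
      intro k _
      rw [← sph_rot (fun z => (v z : ℂ) * f z) (w ^ k) (by simp [hw1])]
      refine integral_congr_ae (Filter.Eventually.of_forall fun x => ?_)
      simp only
      rw [hinv (w ^ k) _ (by rw [← pow_mul, mul_comm, pow_mul, hw.pow_eq_one, one_pow])]
    have h2 := Finset.sum_congr rfl h1
    rw [← integral_finsetSum] at h2
    · rw [Finset.sum_const, Finset.card_range, nsmul_eq_mul] at h2
      push_cast at h2
      rw [← h2, ← integral_const_mul]
      refine integral_congr_ae ?_
      filter_upwards [sph_ae] with x hx
      rw [← Finset.mul_sum, hc _ (by simpa using hx), mul_comm]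
    · intro k _
      apply sph_int
      have := LL.continuous
      fun_prop
  have hc0 : c = 0 := by
    have h3 := key (fun _ => 1) continuous_const (by simp)
    simp only [← hfp, Complex.ofReal_one, one_mul, integral_complex_ofReal, h0] at h3
    have h4 : ∫ x : E 2, (1 : ℂ) ∂(sphMeasure 2) = (2 * Real.pi : ℝ) := by
      rw [integral_const, sph_real]; simp
    rw [h4] at h3
    have : ((2 * Real.pi : ℝ) : ℂ) ≠ 0 := by
      exact_mod_cast (by positivity : (2 * Real.pi : ℝ) ≠ 0)
    simpa [this, Real.pi_ne_zero] using h3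
  have h5 := key v hv hinv
  rw [hc0, zero_mul] at h5
  have h6 : (m + 1 : ℂ) ≠ 0 := by exact_mod_cast Nat.succ_ne_zero m
  have h7 := (mul_eq_zero.mp h5).resolve_left h6
  simp only [← hfp, ← Complex.ofReal_mul, integral_complex_ofReal] at h7
  exact_mod_cast h7

lemma exists_root (n : ℕ) (hn : n ≠ 0) (s : ℂ) (hs : ‖s‖ = 1) : ∃ w : ℂ, w ^ n = s ∧ ‖w‖ = 1 := by
  obtain ⟨w, hw⟩ := IsAlgClosed.exists_pow_nat_eq s (Nat.pos_of_ne_zero hn)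
  refine ⟨w, hw, ?_⟩
  have : ‖w‖ ^ n = 1 := by rw [← norm_pow, hw, hs]
  exact (pow_eq_one_iff_of_nonneg (norm_nonneg _) hn).mp this

lemma mean_zero (n : ℕ) (hn : n ≠ 0) (e : ℝ) :
    ∫ x, e * ((LL x) ^ n).re ∂(sphMeasure 2) = 0 := by
  obtain ⟨w, hw, hw1⟩ := exists_root n hn (-1) (by simp)
  have := sph_rot (fun z => e * (z ^ n).re) w hw1
  simp only [mul_pow, hw, neg_mul, one_mul, Complex.neg_re, mul_neg, integral_neg] at this
  linarith

lemma mean_sq (n : ℕ) (hn : n ≠ 0) :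
    ∫ x, (((LL x) ^ n).re) ^ 2 ∂(sphMeasure 2) = Real.pi := by
  obtain ⟨w, hw, hw1⟩ := exists_root n hn Complex.I (by simp)
  have := sph_rot (fun z => ((z ^ n).re) ^ 2) w hw1
  have hc := LL.continuous
  have h2 : ∫ x, ((w * LL x) ^ n).re ^ 2 + ((LL x) ^ n).re ^ 2 ∂(sphMeasure 2) = 2 * Real.pi := by
    have : ∀ᵐ x ∂(sphMeasure 2), ((w * LL x) ^ n).re ^ 2 + ((LL x) ^ n).re ^ 2 = 1 := by
      filter_upwards [sph_ae] with x hx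
      have h3 : Complex.normSq ((LL x) ^ n) = 1 := by
        rw [Complex.normSq_eq_norm_sq]; simp [hx]
      rw [Complex.normSq_apply] at h3
      rw [mul_pow, hw]
      simp only [Complex.mul_re, Complex.I_re, Complex.I_im]
      linarith
    rw [integral_congr_ae this, integral_const, sph_real]; simp
  rw [integral_add (sph_int (by fun_prop)) (sph_int (by fun_prop)), this] at h2
  linarith

lemma cosh_lower (x : ℝ) : 1 + x ^ 2 / 2 ≤ (Real.exp x + Real.exp (-x)) / 2 := by
  rw [← Real.cosh_eq]
  have : Real.cosh x = 1 + 2 * Real.sinh (x / 2) ^ 2 := by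
    have := Real.cosh_two_mul (x / 2)
    rw [show 2 * (x / 2) = x by ring] at this
    rw [this, Real.cosh_sq]; ring
  have h2 : (x / 2) ^ 2 ≤ Real.sinh (x / 2) ^ 2 := by
    rw [sq_le_sq, Real.abs_sinh]
    exact Real.self_le_sinh_iff.mpr (abs_nonneg _)
  nlinarith

lemma mean_exp (n : ℕ) (hn : n ≠ 0) (e : ℝ) :
    2 * Real.pi * (1 + e ^ 2 / 4) ≤ ∫ x, Real.exp (e * ((LL x) ^ n).re) ∂(sphMeasure 2) := by
  obtain ⟨w, hw, hw1⟩ := exists_root n hn (-1) (by simp)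
  have h1 := sph_rot (fun z => Real.exp (e * (z ^ n).re)) w hw1
  simp only [mul_pow, hw, neg_mul, one_mul, Complex.neg_re, mul_neg] at h1
  have hc := LL.continuous
  have h2 : ∫ x, (1 + (e ^ 2 / 2) * ((LL x) ^ n).re ^ 2) ∂(sphMeasure 2) ≤
      ∫ x, (1 / 2) * (Real.exp (e * ((LL x) ^ n).re) + Real.exp (-(e * ((LL x) ^ n).re)))
        ∂(sphMeasure 2) := by
    refine integral_mono (sph_int (by fun_prop)) (sph_int (by fun_prop)) fun x => ?_
    have := cosh_lower (e * ((LL x) ^ n).re)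
    simp only
    linarith
  rw [integral_add (sph_int (by fun_prop)) (sph_int (by fun_prop)), integral_const_mul,
    integral_const_mul, mean_sq n hn, integral_const, sph_real,
    integral_add (sph_int (by fun_prop)) (sph_int (by fun_prop)), h1] at h2
  simp only [smul_eq_mul] at h2
  linarith

lemma fderiv_bound (n : ℕ) (e : ℝ) (x : E 2) :
    ‖fderiv ℝ (fun x : E 2 => e * ((LL x) ^ n).re) x‖ ^ 2 ≤ e ^ 2 * n ^ 2 * ‖x‖ ^ (2 * (n - 1)) := by
  have hL : HasFDerivAt (fun x : E 2 => LL x) (LL.toContinuousLinearEquiv : E 2 →L[ℝ] ℂ) x :=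
    LL.toContinuousLinearEquiv.hasFDerivAt
  have h1 := (hL.pow n)
  have h2 := (Complex.reCLM.hasFDerivAt.comp x h1).const_mul e
  have h3 : ‖fderiv ℝ (fun x : E 2 => e * ((LL x) ^ n).re) x‖ ≤ |e| * n * ‖x‖ ^ (n - 1) := by
    have h4 := h2.fderiv
    simp only [Function.comp_def, Complex.reCLM_apply] at h4
    rw [h4]
    refine ContinuousLinearMap.opNorm_le_bound _ (by positivity) fun v => ?_
    simp only [smul_apply, ContinuousLinearMap.comp_apply, Complex.reCLM_apply, smul_eq_mul, norm_mul, Real.norm_eq_abs]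
    have h5 : |(n • LL x ^ (n - 1) * LL v).re| ≤ n * ‖x‖ ^ (n - 1) * ‖v‖ := by
      refine (Complex.abs_re_le_norm _).trans (le_of_eq ?_)
      simp
    calc |e| * |(n • LL x ^ (n - 1) * LL v).re| ≤ |e| * (n * ‖x‖ ^ (n - 1) * ‖v‖) := by gcongr
      _ = _ := by ring
  calc _ ≤ (|e| * n * ‖x‖ ^ (n - 1)) ^ 2 := by gcongr
    _ = _ := by rw [mul_pow, mul_pow, sq_abs]; ring

lemma energy (n : ℕ) (hn : n ≠ 0) (e : ℝ) :
    ∫ x in Metric.ball (0 : E 2) 1, ‖fderiv ℝ (fun x : E 2 => e * ((LL x) ^ n).re) x‖ ^ 2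
      ≤ e ^ 2 * n * Real.pi := by
  have hvol := vol_ball2
  have h1 : ∫ x in Metric.ball (0 : E 2) 1, e ^ 2 * n ^ 2 * ‖x‖ ^ (2 * (n - 1)) =
      e ^ 2 * n * Real.pi := by
    have h2 := integral_fun_norm_addHaar (volume : Measure (E 2))
      (Set.indicator (Set.Iio 1) fun r : ℝ => e ^ 2 * n ^ 2 * r ^ (2 * (n - 1)))
    have h3 : (fun x : E 2 => (Set.indicator (Set.Iio 1)
        fun r : ℝ => e ^ 2 * n ^ 2 * r ^ (2 * (n - 1))) ‖x‖) =
        Set.indicator (ball (0 : E 2) 1) fun x => e ^ 2 * n ^ 2 * ‖x‖ ^ (2 * (n - 1)) := by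
      ext x
      simp [Set.indicator]
    rw [h3, integral_indicator measurableSet_ball] at h2
    rw [h2, hvol]
    have h4 : ∀ y : ℝ, y ^ (Module.finrank ℝ (E 2) - 1) • (Set.indicator (Set.Iio 1)
        fun r : ℝ => e ^ 2 * n ^ 2 * r ^ (2 * (n - 1))) y =
        Set.indicator (Set.Iio 1) (fun r : ℝ => e ^ 2 * n ^ 2 * r ^ (2 * n - 1)) y := by
      intro y
      by_cases hy : y < 1
      · simp [hy]
        rw [show 2 * n - 1 = 2 * (n - 1) + 1 by omega]; ring
      · simp [hy]
    simp_rw [h4]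
    rw [setIntegral_indicator measurableSet_Iio, Set.Ioi_inter_Iio, ← integral_Ioc_eq_integral_Ioo,
      ← intervalIntegral.integral_of_le zero_le_one, intervalIntegral.integral_const_mul,
      integral_pow]
    have : ((2 * n - 1 : ℕ) : ℝ) + 1 = 2 * n := by
      rw [← Nat.cast_succ, show (2 * n - 1).succ = 2 * n by omega]; push_cast; ring
    rw [this]
    have hn' : (n : ℝ) ≠ 0 := by exact_mod_cast hn
    simp
    field_simp
  rw [← h1]
  apply integral_mono_of_nonneg
  · exact Filter.Eventually.of_forall fun x => by positivity
  · apply IntegrableOn.mono_set _ ball_subset_closedBall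
    apply ContinuousOn.integrableOn_compact (isCompact_closedBall 0 1)
    fun_prop
  · exact Filter.Eventually.of_forall fun x => fderiv_bound n e x

theorem stmt17 (m : ℕ) (a : ℝ)
    (h : ∀ u : E 2 → ℝ, ContDiff ℝ (⊤ : ℕ∞) u →
      (∀ p ∈ P0 2 m,
        ∫ x, Real.exp (u x) * MvPolynomial.eval (fun i => x i) p ∂(sphMeasure 2) = 0) →
      Real.log ((1 / (2 * Real.pi)) *
          ∫ x, Real.exp (u x - (1 / (2 * Real.pi)) * ∫ y, u y ∂(sphMeasure 2))
            ∂(sphMeasure 2)) ≤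
        a * ∫ x in Metric.ball (0 : E 2) 1, ‖fderiv ℝ u x‖ ^ 2) :
    1 / (4 * Real.pi * ((m : ℝ) + 1)) ≤ a := by
  have hpi := Real.pi_pos
  have hm : (0 : ℝ) < (m : ℝ) + 1 := by positivity
  have key : ∀ e : ℝ, e ≠ 0 → 1 / (4 + e ^ 2) ≤ a * (((m : ℝ) + 1) * Real.pi) := by
    intro e he
    have he2 : 0 < e ^ 2 := by positivity
    have hLs : ContDiff ℝ (⊤ : ℕ∞) (fun x : E 2 => LL x) := LL.toContinuousLinearEquiv.contDiff
    have h1 := h (fun x => e * ((LL x) ^ (m + 1)).re)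
      (contDiff_const.mul (Complex.reCLM.contDiff.comp (hLs.pow (m + 1)))) (fun p hp =>
        moments m (fun z => Real.exp (e * (z ^ (m + 1)).re)) (by fun_prop)
          (fun w z hw => by simp only [mul_pow, hw, one_mul]) p hp)
    rw [mean_zero (m + 1) (by omega) e] at h1
    simp only [mul_zero, sub_zero] at h1
    have h2 := mean_exp (m + 1) (by omega) e
    have h3 := energy (m + 1) (by omega) e
    have h0 : 0 ≤ ∫ x in Metric.ball (0 : E 2) 1,
      ‖fderiv ℝ (fun x : E 2 => e * ((LL x) ^ (m + 1)).re) x‖ ^ 2 :=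
        integral_nonneg fun x => by positivity
    have h4 : 1 + e ^ 2 / 4 ≤ (1 / (2 * Real.pi)) *
        ∫ x, Real.exp (e * ((LL x) ^ (m + 1)).re) ∂(sphMeasure 2) := by
      rw [one_div, ← div_eq_inv_mul, le_div_iff₀ (by positivity)]
      linarith
    have h5 := Real.log_le_log (by positivity) h4
    have h6 := Real.one_sub_inv_le_log_of_pos (show 0 < 1 + e ^ 2 / 4 by positivity)
    have h7 : 1 - (1 + e ^ 2 / 4)⁻¹ = e ^ 2 * (1 / (4 + e ^ 2)) := by
      field_simp; ring
    rw [h7] at h6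
    have h8 : 0 < e ^ 2 * (1 / (4 + e ^ 2)) := by positivity
    have ha : 0 < a := by
      by_contra hcon
      have := mul_nonpos_of_nonpos_of_nonneg (not_lt.mp hcon) h0
      linarith
    have h9 := mul_le_mul_of_nonneg_left h3 ha.le
    push_cast at h9
    have h10 : e ^ 2 * (1 / (4 + e ^ 2)) ≤ e ^ 2 * (a * (((m : ℝ) + 1) * Real.pi)) := by
      linarith
    exact le_of_mul_le_mul_left h10 he2
  have hlim : Tendsto (fun e : ℝ => 1 / (4 + e ^ 2)) (nhdsWithin 0 {0}ᶜ) (nhds (1 / 4)) := by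
    have : ContinuousAt (fun e : ℝ => 1 / (4 + e ^ 2)) 0 := by
      apply ContinuousAt.div <;> first | fun_prop | norm_num
    have h2 := this.tendsto
    norm_num at h2
    norm_num
    exact h2.mono_left nhdsWithin_le_nhds
  have := le_of_tendsto hlim (by
    filter_upwards [self_mem_nhdsWithin] with e he
    exact key e he)
  rw [div_le_iff₀ (by positivity)]
  linarith
end
end

section
/- For every integer n ≥ 5, 4(n-4)² ∫₀^∞ ∫₀^∞ [ (s+1)² + t² + (n-2)(1+s) ]² ( (1+s)² + t² )^{-n} t^{n-2} ds dt = n(n-2)(n-4) B( (n-1)/2, (n-1)/2 ), where B denotes the Euler Beta function. -/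
open MeasureTheory Real

lemma aux_beta (u v : ℝ) (hu : 0 < u) (hv : 0 < v) :
    IntegrableOn (fun x : ℝ => x ^ (u - 1) * (1 - x) ^ (v - 1)) (Set.Ioo 0 1) ∧
    ∫ x in Set.Ioo (0:ℝ) 1, x ^ (u - 1) * (1 - x) ^ (v - 1) =
      Real.Gamma u * Real.Gamma v / Real.Gamma (u + v) := by
  have hc : ∀ x ∈ Set.Ioo (0:ℝ) 1, (x : ℂ) ^ ((u:ℂ) - 1) * (1 - (x : ℂ)) ^ ((v:ℂ) - 1)
      = ((x ^ (u - 1) * (1 - x) ^ (v - 1) : ℝ) : ℂ) := by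
    intro x hx
    rw [Complex.ofReal_mul, Complex.ofReal_cpow hx.1.le,
      Complex.ofReal_cpow (by linarith [hx.2] : (0:ℝ) ≤ 1 - x)]
    push_cast
    rfl
  have hI := Complex.betaIntegral_convergent (u := (u:ℂ)) (v := (v:ℂ)) (by simpa) (by simpa)
  rw [intervalIntegrable_iff_integrableOn_Ioo_of_le zero_le_one] at hI
  have hI2 := hI.congr_fun hc measurableSet_Ioo
  refine ⟨by simpa [IntegrableOn] using hI2.re, ?_⟩
  have h1 := Complex.betaIntegral_eq_Gamma_mul_div (u:ℂ) (v:ℂ) (by simpa) (by simpa)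
  rw [Complex.betaIntegral, intervalIntegral.integral_of_le zero_le_one,
    integral_Ioc_eq_integral_Ioo, setIntegral_congr_fun measurableSet_Ioo hc,
    integral_complex_ofReal, ← Complex.ofReal_add, Complex.Gamma_ofReal, Complex.Gamma_ofReal,
    Complex.Gamma_ofReal] at h1
  exact_mod_cast h1

lemma aux_int (a m q : ℝ) (ha : 0 < a) (hm : 0 < m) (hq : 0 < q) :
    IntegrableOn (fun t : ℝ => (a ^ 2 + t ^ 2) ^ (-(m + q)) * t ^ (2 * m - 1)) (Set.Ioi 0) ∧
    ∫ t in Set.Ioi (0:ℝ), (a ^ 2 + t ^ 2) ^ (-(m + q)) * t ^ (2 * m - 1) =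
      a ^ (-(2 * q)) / 2 * (Real.Gamma m * Real.Gamma q / Real.Gamma (m + q)) := by
  obtain ⟨hB, hB2⟩ := aux_beta m q hm hq
  have hR : ∀ t : ℝ, 0 < a ^ 2 + t ^ 2 := fun t => by positivity
  have himg : (fun t : ℝ => t ^ 2 / (a ^ 2 + t ^ 2)) '' Set.Ioi 0 = Set.Ioo 0 1 := by
    ext y
    constructor
    · rintro ⟨t, ht, rfl⟩
      have ht' : 0 < t := ht
      refine ⟨by positivity, ?_⟩
      rw [div_lt_one (hR t)]
      nlinarith
    · rintro ⟨h0, h1⟩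
      have h2 : 0 < 1 - y := by linarith
      refine ⟨a * √(y / (1 - y)), ?_, ?_⟩
      · rw [Set.mem_Ioi]
        positivity
      · simp only [mul_pow]
        rw [Real.sq_sqrt (by positivity)]
        field_simp
        ring
  have hder : ∀ t ∈ Set.Ioi (0:ℝ), HasDerivWithinAt (fun t : ℝ => t ^ 2 / (a ^ 2 + t ^ 2))
      (2 * t * a ^ 2 / (a ^ 2 + t ^ 2) ^ 2) (Set.Ioi 0) t := by
    intro t _
    have h1 : HasDerivAt (fun t : ℝ => t ^ 2) (2 * t) t := by simpa using hasDerivAt_pow 2 t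
    have h2 := h1.div (h1.const_add (a ^ 2)) (hR t).ne'
    refine (h2.congr_deriv ?_).hasDerivWithinAt
    ring
  have hinj : Set.InjOn (fun t : ℝ => t ^ 2 / (a ^ 2 + t ^ 2)) (Set.Ioi 0) := by
    intro x hx y hy hxy
    have hx' : 0 < x := hx
    have hy' : 0 < y := hy
    simp only at hxy
    rw [div_eq_div_iff (hR x).ne' (hR y).ne'] at hxy
    have h3 : a ^ 2 * x ^ 2 = a ^ 2 * y ^ 2 := by linarith
    have h4 := mul_left_cancel₀ (by positivity) h3
    exact (pow_left_inj₀ hx'.le hy'.le two_ne_zero).1 h4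
  have hpt : ∀ t ∈ Set.Ioi (0:ℝ), |2 * t * a ^ 2 / (a ^ 2 + t ^ 2) ^ 2| •
      ((t ^ 2 / (a ^ 2 + t ^ 2)) ^ (m - 1) * (1 - t ^ 2 / (a ^ 2 + t ^ 2)) ^ (q - 1)) =
      (2 * a ^ (2 * q)) * ((a ^ 2 + t ^ 2) ^ (-(m + q)) * t ^ (2 * m - 1)) := by
    intro t ht
    have ht' : 0 < t := ht
    have hRt := hR t
    have e1 : 1 - t ^ 2 / (a ^ 2 + t ^ 2) = a ^ 2 / (a ^ 2 + t ^ 2) := by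
      field_simp
      ring
    rw [abs_of_pos (by positivity), e1, smul_eq_mul]
    have e2 : (a ^ 2) ^ q = a ^ (2 * q) := by
      rw [Real.rpow_mul ha.le, Real.rpow_two]
    have e3 : (t ^ 2) ^ m = t ^ (2 * m) := by
      rw [Real.rpow_mul ht'.le, Real.rpow_two]
    set R := a ^ 2 + t ^ 2 with hRdef
    rw [Real.div_rpow (by positivity) hRt.le, Real.div_rpow (by positivity) hRt.le,
      Real.rpow_sub_one (by positivity), Real.rpow_sub_one (by positivity),
      Real.rpow_sub_one (by positivity), Real.rpow_sub_one (by positivity),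
      Real.rpow_sub_one (by positivity), e2, e3, Real.rpow_neg hRt.le, Real.rpow_add hRt]
    have p1 : 0 < R ^ m := by positivity
    have p2 : 0 < R ^ q := by positivity
    generalize R ^ m = X at *
    generalize R ^ q = Y at *
    generalize t ^ (2 * m) = Z
    generalize a ^ (2 * q) = W
    clear_value R
    field_simp
  have hc : 0 < a ^ (2 * q) := by positivity
  rw [← himg, integrableOn_image_iff_integrableOn_abs_deriv_smul measurableSet_Ioi hder hinj] at hB
  rw [← himg, integral_image_eq_integral_abs_deriv_smul measurableSet_Ioi hder hinj,
    setIntegral_congr_fun measurableSet_Ioi hpt, integral_const_mul] at hB2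
  have hB3 := hB.congr_fun hpt measurableSet_Ioi
  constructor
  · have := hB3.const_mul (2 * a ^ (2 * q))⁻¹
    refine IntegrableOn.congr_fun this (fun t _ => ?_) measurableSet_Ioi
    rw [inv_mul_cancel_left₀ (by positivity)]
  · rw [← hB2, Real.rpow_neg ha.le]
    field_simp

lemma aux_lin (f g h : ℝ → ℝ) (c d e : ℝ) (S : Set ℝ) (hf : IntegrableOn f S)
    (hg : IntegrableOn g S) (hh : IntegrableOn h S) :
    ∫ x in S, (c * f x + d * g x + e * h x) =
      c * (∫ x in S, f x) + d * (∫ x in S, g x) + e * (∫ x in S, h x) := by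
  have h1 : Integrable (fun x => c * f x + d * g x) (volume.restrict S) :=
    (hf.const_mul c).add (hg.const_mul d)
  rw [integral_add h1 (hh.const_mul e), integral_add (hf.const_mul c) (hg.const_mul d),
    integral_const_mul, integral_const_mul, integral_const_mul]

lemma aux_inner (n a : ℝ) (hn : 5 ≤ n) (ha : 0 < a) :
    ∫ t in Set.Ioi (0:ℝ), (a ^ 2 + t ^ 2 + (n - 2) * a) ^ 2 *
            (a ^ 2 + t ^ 2) ^ (-n) * t ^ (n - 2) =
    (Real.Gamma ((n - 1) / 2) * Real.Gamma ((n - 1) / 2) /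
          Real.Gamma ((n - 1) / 2 + (n - 1) / 2)) *
      ((n - 2) / (n - 3) * a ^ (3 - n) + (n - 2) * a ^ (2 - n) + (n - 2) ^ 2 / 4 * a ^ (1 - n)) := by
  set m := (n - 1) / 2 with hm
  have hnm : n = 2 * m + 1 := by rw [hm]; ring
  have hm2 : 2 ≤ m := by linarith
  clear_value m
  subst hnm
  obtain ⟨i1, v1⟩ := aux_int a m (m - 1) ha (by linarith) (by linarith)
  obtain ⟨i2, v2⟩ := aux_int a m m ha (by linarith) (by linarith)
  obtain ⟨i3, v3⟩ := aux_int a m (m + 1) ha (by linarith) (by linarith)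
  have hpt : ∀ t ∈ Set.Ioi (0:ℝ), (a ^ 2 + t ^ 2 + (2 * m + 1 - 2) * a) ^ 2 *
            (a ^ 2 + t ^ 2) ^ (-(2 * m + 1)) * t ^ (2 * m + 1 - 2) =
      (1 * ((a ^ 2 + t ^ 2) ^ (-(m + (m - 1))) * t ^ (2 * m - 1)) +
       (2 * (2 * m - 1) * a) * ((a ^ 2 + t ^ 2) ^ (-(m + m)) * t ^ (2 * m - 1))) +
       ((2 * m - 1) ^ 2 * a ^ 2) * ((a ^ 2 + t ^ 2) ^ (-(m + (m + 1))) * t ^ (2 * m - 1)) := by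
    intro t _
    have hR : 0 < a ^ 2 + t ^ 2 := by positivity
    have e1 : -(m + (m - 1)) = -(2 * m + 1) + 2 := by ring
    have e2 : -(m + m) = -(2 * m + 1) + 1 := by ring
    have e3 : -(m + (m + 1)) = -(2 * m + 1) := by ring
    have e4 : 2 * m + 1 - 2 = 2 * m - 1 := by ring
    rw [e1, e2, e3, e4, Real.rpow_add hR, Real.rpow_add_one hR.ne', Real.rpow_two]
    ring
  rw [setIntegral_congr_fun measurableSet_Ioi hpt, aux_lin _ _ _ _ _ _ _ i1 i2 i3,
    v1, v2, v3]
  have g1 : Real.Gamma m = (m - 1) * Real.Gamma (m - 1) := by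
    have := Real.Gamma_add_one (s := m - 1) (by linarith)
    simpa using this
  have g2 : Real.Gamma (m + 1) = m * Real.Gamma m := Real.Gamma_add_one (by linarith)
  have g3 : Real.Gamma (m + m) = (m + (m - 1)) * Real.Gamma (m + (m - 1)) := by
    rw [← Real.Gamma_add_one (by linarith)]
    congr 1
    ring
  have g4 : Real.Gamma (m + (m + 1)) = (m + m) * Real.Gamma (m + m) := by
    rw [← Real.Gamma_add_one (by linarith)]
    congr 1
    ring
  have p1 : a ^ (-(2 * (m - 1))) = a ^ (3 - (2 * m + 1)) := by congr 1; ring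
  have p2 : a ^ (2 - (2 * m + 1)) = a ^ (-(2 * m)) * a := by
    rw [← Real.rpow_add_one ha.ne']; congr 1; ring
  have p3 : a ^ (1 - (2 * m + 1)) = a ^ (-(2 * (m + 1))) * a ^ 2 := by
    rw [← Real.rpow_two, ← Real.rpow_add ha]; congr 1; ring
  rw [p1, p2, p3, g4, g3, g2, g1]
  have hG : 0 < Real.Gamma (m + (m - 1)) := Real.Gamma_pos_of_pos (by linarith)
  have q1 : m - 1 ≠ 0 := by linarith
  have q2 : m + (m - 1) ≠ 0 := by linarith
  have q3 : 2 * m + 1 - 3 ≠ 0 := by linarith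
  have q4 : m ≠ 0 := by linarith
  have q5 : 2 * m - 1 = m + (m - 1) := by ring
  have q6 : 2 * m + 1 - 2 = m + (m - 1) := by ring
  have q7 : 2 * m + 1 - 3 = 2 * (m - 1) := by ring
  rw [q5, q6, q7]
  generalize Real.Gamma (m + (m - 1)) = G at *
  generalize Real.Gamma (m - 1) = H at *
  generalize a ^ (3 - (2 * m + 1)) = A1
  generalize a ^ (-(2 * m)) = A2
  generalize a ^ (-(2 * (m + 1))) = A3
  field_simp
  ring

lemma aux_shift (c : ℝ) (hc : c < -1) :
    IntegrableOn (fun s : ℝ => (1 + s) ^ c) (Set.Ioi 0) ∧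
    ∫ s in Set.Ioi (0:ℝ), (1 + s) ^ c = -1 / (c + 1) := by
  constructor
  · have := integrableOn_add_rpow_Ioi_of_lt hc (by norm_num : -(1:ℝ) < 0)
    simpa [add_comm] using this
  · have h := integral_Ioi_rpow_of_lt hc one_pos
    rw [Real.one_rpow] at h
    rw [← h]
    have := (measurePreserving_add_left volume (1:ℝ)).setIntegral_preimage_emb
      (measurableEmbedding_addLeft 1) (fun x : ℝ => x ^ c) (Set.Ioi 1)
    simpa using this

theorem stmt18 (n : ℕ) (hn : 5 ≤ n) :
    4 * ((n:ℝ) - 4) ^ 2 *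
        ∫ s in Set.Ioi (0:ℝ), ∫ t in Set.Ioi (0:ℝ),
          ((s + 1) ^ 2 + t ^ 2 + ((n:ℝ) - 2) * (1 + s)) ^ 2 *
            ((1 + s) ^ 2 + t ^ 2) ^ (-(n:ℝ)) * t ^ ((n:ℝ) - 2) =
      (n:ℝ) * ((n:ℝ) - 2) * ((n:ℝ) - 4) *
        (Real.Gamma (((n:ℝ) - 1) / 2) * Real.Gamma (((n:ℝ) - 1) / 2) /
          Real.Gamma (((n:ℝ) - 1) / 2 + ((n:ℝ) - 1) / 2)) := by
  have hx : (5:ℝ) ≤ (n:ℝ) := by exact_mod_cast hn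
  generalize (n:ℝ) = x at *
  have hs : ∀ s ∈ Set.Ioi (0:ℝ), _ = _ := fun s (h : 0 < s) =>
    aux_inner x (1 + s) hx (by linarith)
  obtain ⟨i1, v1⟩ := aux_shift (3 - x) (by linarith)
  obtain ⟨i2, v2⟩ := aux_shift (2 - x) (by linarith)
  obtain ⟨i3, v3⟩ := aux_shift (1 - x) (by linarith)
  simp only [add_comm _ (1:ℝ)]
  rw [setIntegral_congr_fun measurableSet_Ioi hs, integral_const_mul,
    aux_lin _ _ _ _ _ _ _ i1 i2 i3, v1, v2, v3]
  generalize Real.Gamma ((x - 1) / 2) * Real.Gamma ((x - 1) / 2) /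
          Real.Gamma ((x - 1) / 2 + (x - 1) / 2) = B
  have h2 : x - 2 ≠ 0 := by linarith
  have h3 : x - 3 ≠ 0 := by linarith
  have h4 : x - 4 ≠ 0 := by linarith
  have e1 : -1 / (3 - x + 1) = 1 / (x - 4) := by
    rw [show 3 - x + 1 = -(x - 4) by ring, neg_div_neg_eq]
  have e2 : -1 / (2 - x + 1) = 1 / (x - 3) := by
    rw [show 2 - x + 1 = -(x - 3) by ring, neg_div_neg_eq]
  have e3 : -1 / (1 - x + 1) = 1 / (x - 2) := by
    rw [show 1 - x + 1 = -(x - 2) by ring, neg_div_neg_eq]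
  rw [e1, e2, e3]
  field_simp
  ring
end

section
/- Let n ≥ 5 and define ψ̂ : ℝⁿ₊ → ℝ on the upper half-space ℝⁿ₊ = { z = (z', z_n) ∈ ℝ^{n-1} × ℝ : z_n > 0 } by ψ̂(z) = [ 1 + (n-4) z_n / ( (1+z_n)² + |z'|² ) ] · ( 2 / ( (1+z_n)² + |z'|² ) )^{(n-4)/2}. Then ψ̂ is biharmonic in ℝⁿ₊ with boundary values ψ̂(z', 0) = ( 2/(1+|z'|²) )^{(n-4)/2} and ∂_{z_n} ψ̂ = 0 on ℝ^{n-1}, and ∫_{ℝⁿ₊} (Δψ̂)² dz = ( n(n-2)(n-4)/4 ) |S^{n-1}|, where |S^{n-1}| is the total surface measure of the unit sphere in ℝⁿ. -/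
open MeasureTheory Metric Filter
open scoped ENNReal RealInnerProductSpace

noncomputable section

/-- `|S^{n-1}|` : the total mass of the surface measure. -/
def SA (n : ℕ) : ℝ := (sphMeasure n Set.univ).toReal

/-- The Euclidean Laplacian `Δu = Σ_i ∂²u/∂x_i²`. -/
def lap (n : ℕ) (u : E n → ℝ) (x : E n) : ℝ :=
  ∑ i : Fin n, fderiv ℝ (fun y => fderiv ℝ u y (EuclideanSpace.single i 1)) x
    (EuclideanSpace.single i 1)

/-- `(1+z_n)² + |z'|²`, where `z_n = z i₀` is the last coordinate and
`|z'|² = ‖z‖² - z_n²`. -/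
def denom (n : ℕ) (i₀ : Fin n) (z : E n) : ℝ := (1 + z i₀) ^ 2 + (‖z‖ ^ 2 - (z i₀) ^ 2)

/-- The function `ψ̂(z) = [1 + (n-4) z_n/((1+z_n)² + |z'|²)] (2/((1+z_n)² + |z'|²))^{(n-4)/2}`
on the upper half-space. -/
def psiHat (n : ℕ) (i₀ : Fin n) (z : E n) : ℝ :=
  (1 + ((n:ℝ) - 4) * z i₀ / denom n i₀ z) * (2 / denom n i₀ z) ^ (((n:ℝ) - 4) / 2)


/-- the building block `(α + β z_n) D^s` -/
def qf (n : ℕ) (i₀ : Fin n) (α β s : ℝ) (z : E n) : ℝ := (α + β * z i₀) * (denom n i₀ z) ^ s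

def dl {n : ℕ} (i₀ i : Fin n) : ℝ := if i = i₀ then 1 else 0

lemma denom_hasFDerivAt (n : ℕ) (i₀ : Fin n) (z : E n) :
    ∃ L : E n →L[ℝ] ℝ, HasFDerivAt (denom n i₀) L z ∧
      ∀ i, L (EuclideanSpace.single i 1) = 2 * (z i + dl i₀ i) := by
  have h0 : HasFDerivAt (fun z : E n => z i₀) (EuclideanSpace.proj i₀ : E n →L[ℝ] ℝ) z :=
    (EuclideanSpace.proj i₀ : E n →L[ℝ] ℝ).hasFDerivAt
  have h1 : HasFDerivAt (fun z : E n => ‖z‖ ^ 2) (2 • innerSL ℝ z) z :=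
    (hasStrictFDerivAt_norm_sq z).hasFDerivAt
  have h2 := ((h0.const_add 1).pow 2).add (h1.sub (h0.pow 2))
  refine ⟨_, h2, fun i => ?_⟩
  by_cases h : i = i₀
  · subst h
    simp [dl, EuclideanSpace.inner_single_right]
    ring
  · have h' : i₀ ≠ i := fun e => h e.symm
    simp [dl, h, h', EuclideanSpace.inner_single_right]

lemma denom_cont (n : ℕ) (i₀ : Fin n) : Continuous (denom n i₀) := by
  rw [continuous_iff_continuousAt]
  intro z
  obtain ⟨L, hL, _⟩ := denom_hasFDerivAt n i₀ z
  exact hL.continuousAt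

lemma qf_hasFDerivAt (n : ℕ) (i₀ : Fin n) (α β s : ℝ) (z : E n) (hz : 0 < denom n i₀ z) :
    ∃ L : E n →L[ℝ] ℝ, HasFDerivAt (qf n i₀ α β s) L z ∧
      ∀ i, L (EuclideanSpace.single i 1) = β * dl i₀ i * denom n i₀ z ^ s +
        2 * s * (z i + dl i₀ i) * ((α + β * z i₀) * denom n i₀ z ^ (s - 1)) := by
  obtain ⟨L, hL, hLi⟩ := denom_hasFDerivAt n i₀ z
  have h0 : HasFDerivAt (fun z : E n => z i₀) (EuclideanSpace.proj i₀ : E n →L[ℝ] ℝ) z :=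
    (EuclideanSpace.proj i₀ : E n →L[ℝ] ℝ).hasFDerivAt
  have h1 := hL.rpow_const (p := s) (Or.inl hz.ne')
  have h2 := ((h0.const_mul β).const_add α).mul h1
  refine ⟨_, h2, fun i => ?_⟩
  by_cases h : i = i₀
  · subst h
    simp [hLi, dl]
    ring
  · have h' : i₀ ≠ i := fun e => h e.symm
    simp [hLi, dl, h, h']
    ring

lemma qf_diff (n : ℕ) (i₀ : Fin n) (α β s : ℝ) (z : E n) (hz : 0 < denom n i₀ z) :
    DifferentiableAt ℝ (qf n i₀ α β s) z := by
  obtain ⟨L, hL, _⟩ := qf_hasFDerivAt n i₀ α β s z hz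
  exact hL.differentiableAt

lemma qf_fderiv (n : ℕ) (i₀ : Fin n) (α β s : ℝ) (z : E n) (hz : 0 < denom n i₀ z) (i : Fin n) :
    fderiv ℝ (qf n i₀ α β s) z (EuclideanSpace.single i 1) = qf n i₀ (β * dl i₀ i) 0 s z +
      (z i + dl i₀ i) * qf n i₀ (2 * s * α) (2 * s * β) (s - 1) z := by
  obtain ⟨L, hL, h⟩ := qf_hasFDerivAt n i₀ α β s z hz
  rw [hL.fderiv, h]
  simp only [qf]
  ring

lemma denom_ev (n : ℕ) (i₀ : Fin n) (z : E n) (hz : 0 < denom n i₀ z) :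
    ∀ᶠ y in nhds z, 0 < denom n i₀ y :=
  (denom_cont n i₀).continuousAt.eventually (lt_mem_nhds hz)

lemma denom_sum (n : ℕ) (i₀ : Fin n) (z : E n) :
    ∑ i, (z i + dl i₀ i) ^ 2 = denom n i₀ z := by
  have : ∀ i, (z i + dl i₀ i) ^ 2 = z i ^ 2 + (if i = i₀ then 2 * z i + 1 else 0) := by
    intro i
    unfold dl
    split_ifs <;> ring
  simp only [this, Finset.sum_add_distrib, Finset.sum_ite_eq', denom, EuclideanSpace.norm_sq_eq]
  simp
  ring

/-- second derivative -/
lemma qf_fderiv2 (n : ℕ) (i₀ : Fin n) (α β s : ℝ) (z : E n) (hz : 0 < denom n i₀ z) (i : Fin n) :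
    DifferentiableAt ℝ (fun y => fderiv ℝ (qf n i₀ α β s) y (EuclideanSpace.single i 1)) z ∧
    fderiv ℝ (fun y => fderiv ℝ (qf n i₀ α β s) y (EuclideanSpace.single i 1)) z
      (EuclideanSpace.single i 1) =
      (if i = i₀ then 4 * s * β * (z i + 1) * denom n i₀ z ^ (s - 1) else 0) +
      qf n i₀ (2 * s * α) (2 * s * β) (s - 1) z +
      (z i + dl i₀ i) ^ 2 * (4 * s * (s - 1) * (α + β * z i₀) * denom n i₀ z ^ (s - 2)) := by
  have hev : (fun y => fderiv ℝ (qf n i₀ α β s) y (EuclideanSpace.single i 1)) =ᶠ[nhds z]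
      fun y => qf n i₀ (β * dl i₀ i) 0 s y +
      (y i + dl i₀ i) * qf n i₀ (2 * s * α) (2 * s * β) (s - 1) y := by
    filter_upwards [denom_ev n i₀ z hz] with y hy
    exact qf_fderiv n i₀ α β s y hy i
  obtain ⟨L1, hL1, h1⟩ := qf_hasFDerivAt n i₀ (β * dl i₀ i) 0 s z hz
  obtain ⟨L2, hL2, h2⟩ := qf_hasFDerivAt n i₀ (2 * s * α) (2 * s * β) (s - 1) z hz
  have h0 : HasFDerivAt (fun z : E n => z i) (EuclideanSpace.proj i : E n →L[ℝ] ℝ) z :=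
    (EuclideanSpace.proj i : E n →L[ℝ] ℝ).hasFDerivAt
  have h3 := (hL1.add ((h0.add_const (dl i₀ i)).mul hL2)).congr_of_eventuallyEq hev
  refine ⟨h3.differentiableAt, ?_⟩
  rw [h3.fderiv]
  have e : s - 1 - 1 = s - 2 := by ring
  simp [h1, h2, qf, e]
  unfold dl
  split_ifs with h
  · subst h
    ring
  · ring

lemma lap_qf (n : ℕ) (i₀ : Fin n) (α β s : ℝ) (z : E n) (hz : 0 < denom n i₀ z) :
    lap n (qf n i₀ α β s) z = qf n i₀ (4 * s * β + s * (4 * (s - 1) + 2 * n) * α)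
      (4 * s * β + s * (4 * (s - 1) + 2 * n) * β) (s - 1) z := by
  unfold lap
  rw [Finset.sum_congr rfl fun i _ => (qf_fderiv2 n i₀ α β s z hz i).2]
  simp only [Finset.sum_add_distrib, ← Finset.sum_mul, denom_sum]
  have : denom n i₀ z ^ (s - 1) = denom n i₀ z ^ (s - 2) * denom n i₀ z := by
    rw [← Real.rpow_add_one hz.ne']
    congr 1
    ring
  simp [qf, this]
  ring

lemma lap_congr (n : ℕ) (u v : E n → ℝ) (z : E n) (h : u =ᶠ[nhds z] v) :
    lap n u z = lap n v z := by
  unfold lap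
  refine Finset.sum_congr rfl fun i _ => ?_
  have : (fun y => fderiv ℝ u y (EuclideanSpace.single i 1)) =ᶠ[nhds z]
      (fun y => fderiv ℝ v y (EuclideanSpace.single i 1)) := by
    filter_upwards [h.fderiv (𝕜 := ℝ)] with y hy
    rw [hy]
  rw [this.fderiv_eq]

lemma lap_qf_add (n : ℕ) (i₀ : Fin n) (α β s α' β' s' : ℝ) (z : E n) (hz : 0 < denom n i₀ z) :
    lap n (fun y => qf n i₀ α β s y + qf n i₀ α' β' s' y) z =
      lap n (qf n i₀ α β s) z + lap n (qf n i₀ α' β' s') z := by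
  unfold lap
  rw [← Finset.sum_add_distrib]
  refine Finset.sum_congr rfl fun i _ => ?_
  have : (fun y => fderiv ℝ (fun y => qf n i₀ α β s y + qf n i₀ α' β' s' y) y
      (EuclideanSpace.single i 1)) =ᶠ[nhds z]
      (fun y => fderiv ℝ (qf n i₀ α β s) y (EuclideanSpace.single i 1)) +
      (fun y => fderiv ℝ (qf n i₀ α' β' s') y (EuclideanSpace.single i 1)) := by
    filter_upwards [denom_ev n i₀ z hz] with y hy
    rw [fderiv_fun_add (qf_diff _ _ _ _ _ _ hy) (qf_diff _ _ _ _ _ _ hy)]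
    rfl
  rw [this.fderiv_eq, fderiv_add (qf_fderiv2 n i₀ α β s z hz i).1
    (qf_fderiv2 n i₀ α' β' s' z hz i).1]
  rfl

lemma psi_eq (n : ℕ) (i₀ : Fin n) (z : E n) (hz : 0 < denom n i₀ z) :
    psiHat n i₀ z = qf n i₀ (2 ^ (((n:ℝ) - 4) / 2)) 0 (-(((n:ℝ) - 4) / 2)) z +
      qf n i₀ 0 (((n:ℝ) - 4) * 2 ^ (((n:ℝ) - 4) / 2)) (-(((n:ℝ) - 4) / 2) - 1) z := by
  unfold psiHat qf
  rw [Real.div_rpow (by norm_num) hz.le, Real.rpow_sub_one hz.ne', Real.rpow_neg hz.le]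
  field_simp
  ring

lemma lap_psi (n : ℕ) (i₀ : Fin n) (z : E n) (hz : 0 < denom n i₀ z) :
    lap n (psiHat n i₀) z =
      qf n i₀ (-2 * ((n:ℝ) - 4) * 2 ^ (((n:ℝ) - 4) / 2)) 0 (-(((n:ℝ) - 2) / 2)) z +
      qf n i₀ (-2 * ((n:ℝ) - 4) * ((n:ℝ) - 2) * 2 ^ (((n:ℝ) - 4) / 2))
        (-2 * ((n:ℝ) - 4) * ((n:ℝ) - 2) * 2 ^ (((n:ℝ) - 4) / 2)) (-((n:ℝ) / 2)) z := by
  rw [lap_congr n _ _ z ((denom_ev n i₀ z hz).mono fun y hy => psi_eq n i₀ y hy),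
    lap_qf_add _ _ _ _ _ _ _ _ _ hz, lap_qf _ _ _ _ _ _ hz, lap_qf _ _ _ _ _ _ hz]
  congr 2 <;> ring

lemma lap_lap_psi (n : ℕ) (i₀ : Fin n) (z : E n) (hz : 0 < denom n i₀ z) :
    lap n (lap n (psiHat n i₀)) z = 0 := by
  rw [lap_congr n _ _ z ((denom_ev n i₀ z hz).mono fun y hy => lap_psi n i₀ y hy),
    lap_qf_add _ _ _ _ _ _ _ _ _ hz, lap_qf _ _ _ _ _ _ hz, lap_qf _ _ _ _ _ _ hz]
  simp only [qf]
  ring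

lemma denom_pos (n : ℕ) (i₀ : Fin n) (z : E n) (hz : 0 ≤ z i₀) : 0 < denom n i₀ z := by
  unfold denom
  nlinarith [sq_nonneg ‖z‖]

lemma bdry_deriv (n : ℕ) (i₀ : Fin n) (z : E n) (hz : z i₀ = 0) :
    fderiv ℝ (psiHat n i₀) z (EuclideanSpace.single i₀ 1) = 0 := by
  have hd := denom_pos n i₀ z hz.ge
  have h : psiHat n i₀ =ᶠ[nhds z] _ := (denom_ev n i₀ z hd).mono fun y hy => psi_eq n i₀ y hy
  rw [h.fderiv_eq, fderiv_fun_add (qf_diff _ _ _ _ _ _ hd) (qf_diff _ _ _ _ _ _ hd),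
    add_apply, qf_fderiv _ _ _ _ _ _ hd, qf_fderiv _ _ _ _ _ _ hd]
  simp [qf, hz, dl]
  ring

lemma lint_pi_prod (n : ℕ) (f : Fin n → ℝ → ℝ≥0∞) (hf : ∀ i, Measurable (f i)) :
    ∫⁻ x : Fin n → ℝ, ∏ i, f i (x i) = ∏ i, ∫⁻ t, f i t := by
  induction n with
  | zero => simp [volume_pi, lintegral_unique]
  | succ n ih =>
    have h1 : Measurable fun x : Fin n → ℝ => ∏ i, f (Fin.succ i) (x i) :=
      Finset.measurable_prod _ fun i _ => (hf _).comp (measurable_pi_apply i)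
    rw [← ((volume_preserving_piFinSuccAbove (fun _ => ℝ) 0).symm).lintegral_comp_emb
      (MeasurableEquiv.measurableEmbedding _), Fin.prod_univ_succ, ← ih _ fun i => hf _,
      ← lintegral_prod_mul (hf 0).aemeasurable h1.aemeasurable]
    simp [Fin.prod_univ_succ, MeasurableEquiv.piFinSuccAbove_symm_apply, Fin.insertNthEquiv]
    rfl

lemma lint_E_prod (n : ℕ) (f : Fin n → ℝ → ℝ≥0∞) (hf : ∀ i, Measurable (f i)) :
    ∫⁻ x : E n, ∏ i, f i (x i) = ∏ i, ∫⁻ t, f i t := by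
  rw [← lint_pi_prod n f hf, ← (PiLp.volume_preserving_ofLp (Fin n)).lintegral_comp_emb
    (MeasurableEquiv.toLp 2 (Fin n → ℝ)).symm.measurableEmbedding]

lemma lint_of_int {X : Type*} [MeasurableSpace X] {μ : Measure X} {f : X → ℝ} {c : ℝ}
    (hf : 0 ≤ᵐ[μ] f) (hc : c ≠ 0) (h : ∫ x, f x ∂μ = c) :
    ∫⁻ x, ENNReal.ofReal (f x) ∂μ = ENNReal.ofReal c := by
  rw [← h, ofReal_integral_eq_lintegral_ofReal (.of_integral_ne_zero (by rw [h]; exact hc)) hf]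

lemma int_of_lint {X : Type*} [MeasurableSpace X] {μ : Measure X} {f : X → ℝ} {c : ℝ}
    (hm : Measurable f) (hf : 0 ≤ᵐ[μ] f) (hc : 0 ≤ c)
    (h : ∫⁻ x, ENNReal.ofReal (f x) ∂μ = ENNReal.ofReal c) :
    Integrable f μ ∧ ∫ x, f x ∂μ = c := by
  refine ⟨(lintegral_ofReal_ne_top_iff_integrable hm.aestronglyMeasurable hf).1 (by simp [h]), ?_⟩
  rw [integral_eq_lintegral_of_nonneg_ae hf hm.aestronglyMeasurable, h, ENNReal.toReal_ofReal hc]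

lemma lint_gamma (a r : ℝ) (ha : 0 < a) (hr : 0 < r) :
    ∫⁻ s in Set.Ioi (0:ℝ), ENNReal.ofReal (s ^ (a - 1) * Real.exp (-(r * s))) =
      ENNReal.ofReal (r ^ (-a) * Real.Gamma a) := by
  refine lint_of_int ?_ (by have := Real.Gamma_pos_of_pos ha; positivity) ?_
  · filter_upwards [ae_restrict_mem measurableSet_Ioi] with s hs
    have : 0 < s := hs
    simp only [Pi.zero_apply]
    positivity
  · rw [Real.integral_rpow_mul_exp_neg_mul_Ioi ha hr, one_div, Real.inv_rpow hr.le,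
      Real.rpow_neg hr.le]

lemma lint_gauss (s : ℝ) (hs : 0 < s) :
    ∫⁻ t : ℝ, ENNReal.ofReal (Real.exp (-s * t ^ 2)) = ENNReal.ofReal (√(Real.pi / s)) := by
  refine lint_of_int (Eventually.of_forall fun t => (Real.exp_pos _).le) ?_ (integral_gaussian s)
  have := Real.pi_pos
  positivity

lemma lint_tail (p : ℝ) (hp : p < -1) :
    ∫⁻ t in Set.Ioi (0:ℝ), ENNReal.ofReal ((1 + t) ^ p) = ENNReal.ofReal (1 / (-p - 1)) := by
  refine lint_of_int ?_ ?_ ?_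
  · filter_upwards [ae_restrict_mem measurableSet_Ioi] with s hs
    have : 0 < s := hs
    simp only [Pi.zero_apply]
    positivity
  · have : 0 < -p - 1 := by linarith
    positivity
  · have h := integral_Ioi_rpow_of_lt hp one_pos
    have h2 : ∫ t in Set.Ioi (0:ℝ), (1 + t) ^ p = ∫ t in Set.Ioi (1:ℝ), t ^ p := by
      rw [← (measurePreserving_add_left volume (1:ℝ)).setIntegral_preimage_emb
        (measurableEmbedding_addLeft 1) (fun t : ℝ => t ^ p) (Set.Ioi 1)]
      simp
    rw [h2, h, Real.one_rpow]
    have : -p - 1 ≠ 0 := by linarith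
    have : p + 1 ≠ 0 := by linarith
    field_simp
    ring

lemma denom_eq_sum (n : ℕ) (i₀ : Fin n) (z : E n) :
    denom n i₀ z = ∑ i, if i = i₀ then (1 + z i) ^ 2 else z i ^ 2 := by
  rw [← denom_sum]
  refine Finset.sum_congr rfl fun i _ => ?_
  unfold dl
  split_ifs <;> ring

lemma lint_inner (n : ℕ) (i₀ : Fin n) (j s : ℝ) (hs : 0 < s) :
    ∫⁻ z in {z : E n | 0 < z i₀}, ENNReal.ofReal ((1 + z i₀) ^ j * Real.exp (-(denom n i₀ z * s)))
    = (∫⁻ t in Set.Ioi (0:ℝ), ENNReal.ofReal ((1 + t) ^ j * Real.exp (-((1 + t) ^ 2 * s)))) *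
      ENNReal.ofReal (√(Real.pi / s)) ^ (n - 1) := by
  set F : Fin n → ℝ → ℝ≥0∞ := fun i => if i = i₀ then
    (Set.Ioi (0:ℝ)).indicator
      (fun t => ENNReal.ofReal ((1 + t) ^ j * Real.exp (-((1 + t) ^ 2 * s))))
    else fun t => ENNReal.ofReal (Real.exp (-s * t ^ 2)) with hF
  have hFm : ∀ i, Measurable (F i) := by
    intro i
    simp only [hF]
    split_ifs
    · refine Measurable.indicator ?_ measurableSet_Ioi
      fun_prop
    · fun_prop
  have hH : MeasurableSet {z : E n | 0 < z i₀} :=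
    measurableSet_lt measurable_const (by fun_prop)
  have key : ∀ z : E n, ({z : E n | 0 < z i₀}).indicator
      (fun z => ENNReal.ofReal ((1 + z i₀) ^ j * Real.exp (-(denom n i₀ z * s)))) z =
      ∏ i, F i (z i) := by
    intro z
    rw [← Finset.mul_prod_erase _ _ (Finset.mem_univ i₀)]
    have e1 : ∏ i ∈ Finset.univ.erase i₀, F i (z i) =
        ENNReal.ofReal (Real.exp (∑ i ∈ Finset.univ.erase i₀, -s * z i ^ 2)) := by
      rw [Real.exp_sum, ENNReal.ofReal_prod_of_nonneg fun i _ => (Real.exp_pos _).le]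
      refine Finset.prod_congr rfl fun i hi => ?_
      simp [hF, Finset.ne_of_mem_erase hi]
    rw [e1]
    by_cases h : 0 < z i₀
    · have e2 : denom n i₀ z = (1 + z i₀) ^ 2 + ∑ i ∈ Finset.univ.erase i₀, z i ^ 2 := by
        rw [denom_eq_sum, ← Finset.add_sum_erase _ _ (Finset.mem_univ i₀)]
        congr 1
        · simp
        · refine Finset.sum_congr rfl fun i hi => ?_
          simp [Finset.ne_of_mem_erase hi]
      rw [Set.indicator_of_mem (show z ∈ {z : E n | 0 < z i₀} from h)]
      simp only [hF, if_true]
      rw [Set.indicator_of_mem (show z i₀ ∈ Set.Ioi (0:ℝ) from h), ← ENNReal.ofReal_mul (by positivity),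
        mul_assoc, ← Real.exp_add, e2, ← Finset.mul_sum]
      congr 3
      ring
    · rw [Set.indicator_of_notMem (show z ∉ {z : E n | 0 < z i₀} from h)]
      simp only [hF, if_true]
      rw [Set.indicator_of_notMem (show z i₀ ∉ Set.Ioi (0:ℝ) from h), zero_mul]
  rw [← lintegral_indicator hH, lintegral_congr key, lint_E_prod n F hFm,
    ← Finset.mul_prod_erase _ _ (Finset.mem_univ i₀)]
  congr 1
  · simp only [hF, if_true]
    rw [lintegral_indicator measurableSet_Ioi]
  · rw [Finset.prod_congr rfl (g := fun _ => ENNReal.ofReal (√(Real.pi / s)))]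
    · simp [Finset.card_erase_of_mem]
    · intro i hi
      simp only [hF, Finset.ne_of_mem_erase hi, if_false]
      exact lint_gauss s hs

lemma lint_main (n : ℕ) (hn : 1 ≤ n) (i₀ : Fin n) (j a b : ℝ) (hb : 0 < b)
    (hab : a = b + ((n:ℝ) - 1) / 2) (hp : j - 2 * b < -1) :
    ∫⁻ z in {z : E n | 0 < z i₀}, ENNReal.ofReal ((1 + z i₀) ^ j * denom n i₀ z ^ (-a)) =
      ENNReal.ofReal (√Real.pi ^ (n - 1) * Real.Gamma b / Real.Gamma a / (2 * b - j - 1)) := by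
  have hn' : (1:ℝ) ≤ n := by exact_mod_cast hn
  have ha : 0 < a := by rw [hab]; linarith
  have hGa := Real.Gamma_pos_of_pos ha
  have hGb := Real.Gamma_pos_of_pos hb
  have hH : MeasurableSet {z : E n | 0 < z i₀} :=
    measurableSet_lt measurable_const (by fun_prop)
  have hdm : Measurable (denom n i₀) := (denom_cont n i₀).measurable
  have hpi : 0 < √Real.pi := Real.sqrt_pos.2 Real.pi_pos
  suffices h : (∫⁻ z in {z : E n | 0 < z i₀},
      ENNReal.ofReal ((1 + z i₀) ^ j * denom n i₀ z ^ (-a))) * ENNReal.ofReal (Real.Gamma a) =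
      ENNReal.ofReal (√Real.pi ^ (n - 1) * Real.Gamma b / (2 * b - j - 1)) by
    have h2 : (∫⁻ z in {z : E n | 0 < z i₀},
      ENNReal.ofReal ((1 + z i₀) ^ j * denom n i₀ z ^ (-a))) =
      ENNReal.ofReal (√Real.pi ^ (n - 1) * Real.Gamma b / (2 * b - j - 1)) /
        ENNReal.ofReal (Real.Gamma a) := by
      rw [ENNReal.eq_div_iff (by simpa using hGa) (by simp), mul_comm]
      exact h
    rw [h2, ← ENNReal.ofReal_div_of_pos hGa]
    congr 1
    ring
  have hmE : Measurable fun z : E n => z i₀ := by fun_prop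
  calc
    _ = ∫⁻ z in {z : E n | 0 < z i₀}, ∫⁻ s in Set.Ioi (0:ℝ),
        ENNReal.ofReal ((1 + z i₀) ^ j * (s ^ (a - 1) * Real.exp (-(denom n i₀ z * s)))) := by
      rw [← lintegral_mul_const _ (by fun_prop)]
      refine setLIntegral_congr_fun hH fun z hz => ?_
      have hz' : 0 < z i₀ := hz
      have hd := denom_pos n i₀ z hz'.le
      have hj : 0 ≤ (1 + z i₀) ^ j := by positivity
      simp only [ENNReal.ofReal_mul hj]
      rw [lintegral_const_mul _ (by fun_prop), lint_gamma a _ ha hd,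
        ENNReal.ofReal_mul (by positivity), mul_assoc]
    _ = ∫⁻ s in Set.Ioi (0:ℝ), ∫⁻ z in {z : E n | 0 < z i₀},
        ENNReal.ofReal ((1 + z i₀) ^ j * (s ^ (a - 1) * Real.exp (-(denom n i₀ z * s)))) := by
      refine lintegral_lintegral_swap (Measurable.aemeasurable ?_)
      unfold Function.uncurry
      fun_prop
    _ = ∫⁻ s in Set.Ioi (0:ℝ), ∫⁻ t in Set.Ioi (0:ℝ),
        ENNReal.ofReal ((√Real.pi ^ (n - 1) * (1 + t) ^ j) *
          (s ^ (b - 1) * Real.exp (-((1 + t) ^ 2 * s)))) := by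
      refine setLIntegral_congr_fun measurableSet_Ioi fun s hs => ?_
      have hs' : 0 < s := hs
      have hsa : 0 ≤ s ^ (a - 1) := by positivity
      have e1 : ∀ z : E n, ENNReal.ofReal ((1 + z i₀) ^ j *
          (s ^ (a - 1) * Real.exp (-(denom n i₀ z * s)))) = ENNReal.ofReal (s ^ (a - 1)) *
          ENNReal.ofReal ((1 + z i₀) ^ j * Real.exp (-(denom n i₀ z * s))) := by
        intro z
        rw [← ENNReal.ofReal_mul hsa]
        congr 1
        ring
      have e2 : √(Real.pi / s) ^ (n - 1) * s ^ (a - 1) = √Real.pi ^ (n - 1) * s ^ (b - 1) := by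
        rw [Real.sqrt_div Real.pi_pos.le, div_pow, Real.sqrt_eq_rpow s, ← Real.rpow_natCast (s ^ _),
          ← Real.rpow_mul hs'.le, div_mul_eq_mul_div, mul_div_assoc, ← Real.rpow_sub hs',
          Nat.cast_sub hn, hab]
        congr 2
        push_cast
        ring
      have hc : 0 ≤ √Real.pi ^ (n - 1) * s ^ (b - 1) := by positivity
      have e3 : ∀ t : ℝ, ENNReal.ofReal ((√Real.pi ^ (n - 1) * (1 + t) ^ j) *
          (s ^ (b - 1) * Real.exp (-((1 + t) ^ 2 * s)))) =
          ENNReal.ofReal (√Real.pi ^ (n - 1) * s ^ (b - 1)) *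
          ENNReal.ofReal ((1 + t) ^ j * Real.exp (-((1 + t) ^ 2 * s))) := by
        intro t
        rw [← ENNReal.ofReal_mul hc]
        congr 1
        ring
      simp only [e1, e3]
      rw [lintegral_const_mul _ (by fun_prop), lintegral_const_mul _ (by fun_prop),
        lint_inner n i₀ j s hs', ← e2, ENNReal.ofReal_mul (by positivity),
        ENNReal.ofReal_pow (by positivity)]
      ring
    _ = ∫⁻ t in Set.Ioi (0:ℝ), ∫⁻ s in Set.Ioi (0:ℝ),
        ENNReal.ofReal ((√Real.pi ^ (n - 1) * (1 + t) ^ j) *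
          (s ^ (b - 1) * Real.exp (-((1 + t) ^ 2 * s)))) := by
      refine lintegral_lintegral_swap (Measurable.aemeasurable ?_)
      unfold Function.uncurry
      fun_prop
    _ = ∫⁻ t in Set.Ioi (0:ℝ), ENNReal.ofReal (√Real.pi ^ (n - 1) * Real.Gamma b) *
        ENNReal.ofReal ((1 + t) ^ (j - 2 * b)) := by
      refine setLIntegral_congr_fun measurableSet_Ioi fun t ht => ?_
      have ht' : 0 < 1 + t := by have : 0 < t := ht; linarith
      have hj : 0 ≤ √Real.pi ^ (n - 1) * (1 + t) ^ j := by positivity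
      simp only [ENNReal.ofReal_mul hj]
      rw [lintegral_const_mul _ (by fun_prop), lint_gamma b _ hb (by positivity),
        ← ENNReal.ofReal_mul (by positivity), ← ENNReal.ofReal_mul (by positivity)]
      congr 1
      rw [← Real.rpow_natCast (1 + t) 2, ← Real.rpow_mul ht'.le, sub_eq_add_neg j,
        Real.rpow_add ht']
      push_cast
      rw [show (2:ℝ) * -b = -(2 * b) by ring]
      ring
    _ = _ := by
      rw [lintegral_const_mul _ (by fun_prop), lint_tail _ hp, ← ENNReal.ofReal_mul (by positivity)]
      congr 1
      rw [mul_one_div]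
      congr 1
      ring

lemma int_main (n : ℕ) (hn : 1 ≤ n) (i₀ : Fin n) (j a b : ℝ) (hb : 0 < b)
    (hab : a = b + ((n:ℝ) - 1) / 2) (hp : j - 2 * b < -1) :
    IntegrableOn (fun z : E n => (1 + z i₀) ^ j * denom n i₀ z ^ (-a)) {z : E n | 0 < z i₀} ∧
    ∫ z in {z : E n | 0 < z i₀}, (1 + z i₀) ^ j * denom n i₀ z ^ (-a) =
      √Real.pi ^ (n - 1) * Real.Gamma b / Real.Gamma a / (2 * b - j - 1) := by
  have hn' : (1:ℝ) ≤ n := by exact_mod_cast hn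
  have ha : 0 < a := by rw [hab]; linarith
  have hGa := Real.Gamma_pos_of_pos ha
  have hGb := Real.Gamma_pos_of_pos hb
  have hH : MeasurableSet {z : E n | 0 < z i₀} :=
    measurableSet_lt measurable_const (by fun_prop)
  have hdm : Measurable (denom n i₀) := (denom_cont n i₀).measurable
  have hmE : Measurable fun z : E n => z i₀ := by fun_prop
  refine int_of_lint (by fun_prop) ?_ ?_ (lint_main n hn i₀ j a b hb hab hp)
  · filter_upwards [ae_restrict_mem hH] with z hz
    have hz' : 0 < z i₀ := hz
    have hd := denom_pos n i₀ z hz'.le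
    simp only [Pi.zero_apply]
    positivity
  · have : 0 < 2 * b - j - 1 := by linarith
    positivity

lemma SA_eq (n : ℕ) (hn : 5 ≤ n) :
    SA n = n * (√Real.pi ^ n / Real.Gamma ((n:ℝ) / 2 + 1)) := by
  have : Nonempty (Fin n) := ⟨⟨0, by omega⟩⟩
  have hG : 0 < Real.Gamma ((n:ℝ) / 2 + 1) := Real.Gamma_pos_of_pos (by positivity)
  unfold SA sphMeasure
  rw [Measure.map_apply measurable_subtype_coe MeasurableSet.univ, Set.preimage_univ,
    Measure.toSphere_apply_univ, EuclideanSpace.volume_ball]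
  simp
  left
  positivity

lemma const_id (n : ℕ) (hn : 5 ≤ n) :
    4 * ((n:ℝ) - 4) ^ 2 * (2 ^ (((n:ℝ) - 4) / 2)) ^ 2 *
     (√Real.pi ^ (n - 1) * Real.Gamma (((n:ℝ) - 3) / 2) / Real.Gamma ((n:ℝ) - 2) / ((n:ℝ) - 4) +
      2 * ((n:ℝ) - 2) * (√Real.pi ^ (n - 1) * Real.Gamma (((n:ℝ) - 1) / 2) / Real.Gamma ((n:ℝ) - 1)
        / ((n:ℝ) - 3)) +
      ((n:ℝ) - 2) ^ 2 * (√Real.pi ^ (n - 1) * Real.Gamma (((n:ℝ) + 1) / 2) / Real.Gamma (n:ℝ)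
        / ((n:ℝ) - 2))) =
    ((n:ℝ) * ((n:ℝ) - 2) * ((n:ℝ) - 4) / 4) * SA n := by
  rw [SA_eq n hn]
  have hn' : (5:ℝ) ≤ n := by exact_mod_cast hn
  obtain ⟨m, rfl⟩ : ∃ m, n = m + 1 := ⟨n - 1, by omega⟩
  set x : ℝ := ((m + 1 : ℕ) : ℝ) with hx
  have g1 : Real.Gamma ((x - 1) / 2) = (x - 3) / 2 * Real.Gamma ((x - 3) / 2) := by
    rw [← Real.Gamma_add_one (by linarith)]
    congr 1
    ring
  have g2 : Real.Gamma ((x + 1) / 2) = (x - 1) / 2 * Real.Gamma ((x - 1) / 2) := by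
    rw [← Real.Gamma_add_one (by linarith)]
    congr 1
    ring
  have g3 : Real.Gamma (x - 1) = (x - 2) * Real.Gamma (x - 2) := by
    rw [← Real.Gamma_add_one (by linarith)]
    congr 1
    ring
  have g4 : Real.Gamma x = (x - 1) * Real.Gamma (x - 1) := by
    rw [← Real.Gamma_add_one (by linarith)]
    congr 1
    ring
  have g5 : Real.Gamma (x / 2 + 1) = x / 2 * ((x - 2) / 2 * Real.Gamma ((x - 2) / 2)) := by
    rw [Real.Gamma_add_one (by linarith), ← Real.Gamma_add_one (s := (x - 2) / 2) (by linarith)]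
    congr 2
    ring
  have g6 := Real.Gamma_mul_Gamma_add_half ((x - 3) / 2)
  have g7 : Real.Gamma (x - 2) = (x - 3) * Real.Gamma (x - 3) := by
    rw [← Real.Gamma_add_one (by linarith)]
    congr 1
    ring
  rw [show (x - 3) / 2 + 1 / 2 = (x - 2) / 2 by ring, show 2 * ((x - 3) / 2) = x - 3 by ring,
    show 1 - (x - 3) = -(x - 4) by ring, Real.rpow_neg (by norm_num)] at g6
  have p1 : ((2:ℝ) ^ ((x - 4) / 2)) ^ 2 = 2 ^ (x - 4) := by
    rw [← Real.rpow_natCast, ← Real.rpow_mul (by norm_num)]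
    congr 1
    push_cast
    ring
  rw [p1, g4, g3, g2, g1, g5, g7, Nat.add_sub_cancel, pow_succ (√Real.pi) m]
  have q1 := Real.Gamma_pos_of_pos (show 0 < x - 3 by linarith)
  have q2 := Real.Gamma_pos_of_pos (show 0 < (x - 3) / 2 by linarith)
  have q3 := Real.Gamma_pos_of_pos (show 0 < (x - 2) / 2 by linarith)
  have q4 : (0:ℝ) < 2 ^ (x - 4) := by positivity
  generalize Real.Gamma (x - 3) = A at *
  generalize Real.Gamma ((x - 3) / 2) = B at *
  generalize Real.Gamma ((x - 2) / 2) = C at *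
  generalize (2:ℝ) ^ (x - 4) = T at *
  have r1 : √Real.pi = B * C * T / A := by
    rw [g6]
    field_simp
  have hpi : 0 < √Real.pi ^ m := pow_pos (Real.sqrt_pos.2 Real.pi_pos) m
  generalize √Real.pi ^ m = P at *
  rw [r1]
  have n1 : x - 1 ≠ 0 := by linarith
  have n2 : x - 2 ≠ 0 := by linarith
  have n3 : x - 3 ≠ 0 := by linarith
  have n4 : x - 4 ≠ 0 := by linarith
  have n5 : x ≠ 0 := by linarith
  field_simp
  ring

lemma int_final (n : ℕ) (hn : 5 ≤ n) (i₀ : Fin n) :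
    (∫ z in {z : E n | 0 < z i₀}, (lap n (psiHat n i₀) z) ^ 2) =
      ((n:ℝ) * ((n:ℝ) - 2) * ((n:ℝ) - 4) / 4) * SA n := by
  have hn' : (5:ℝ) ≤ n := by exact_mod_cast hn
  have hH : MeasurableSet {z : E n | 0 < z i₀} :=
    measurableSet_lt measurable_const (by fun_prop)
  obtain ⟨i1, v1⟩ := int_main n (by omega) i₀ 0 ((n:ℝ) - 2) (((n:ℝ) - 3) / 2) (by linarith)
    (by ring) (by linarith)
  obtain ⟨i2, v2⟩ := int_main n (by omega) i₀ 1 ((n:ℝ) - 1) (((n:ℝ) - 1) / 2) (by linarith)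
    (by ring) (by linarith)
  obtain ⟨i3, v3⟩ := int_main n (by omega) i₀ 2 (n:ℝ) (((n:ℝ) + 1) / 2) (by linarith)
    (by ring) (by linarith)
  rw [← const_id n hn]
  rw [show 2 * (((n:ℝ) - 3) / 2) - 0 - 1 = n - 4 by ring] at v1
  rw [show 2 * (((n:ℝ) - 1) / 2) - 1 - 1 = n - 3 by ring] at v2
  rw [show 2 * (((n:ℝ) + 1) / 2) - 2 - 1 = n - 2 by ring] at v3
  rw [← v1, ← v2, ← v3, ← integral_const_mul, ← integral_const_mul,
    ← integral_add i1 (i2.const_mul _)]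
  have i4 := i1.add (i2.const_mul (2 * ((n:ℝ) - 2)))
  simp only [Pi.add_def] at i4
  rw [← integral_add i4 (i3.const_mul _), ← integral_const_mul]
  refine setIntegral_congr_fun hH fun z hz => ?_
  have hz' : 0 < z i₀ := hz
  have hd := denom_pos n i₀ z hz'.le
  simp only [lap_psi n i₀ z hd, qf]
  have e1 : denom n i₀ z ^ (-((n:ℝ) - 2)) = (denom n i₀ z ^ (-((n:ℝ) / 2))) ^ 2 * denom n i₀ z ^ 2 := by
    rw [← Real.rpow_natCast (_ ^ _), ← Real.rpow_mul hd.le, ← Real.rpow_natCast (denom n i₀ z) 2,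
      ← Real.rpow_add hd]
    congr 1
    push_cast
    ring
  have e2 : denom n i₀ z ^ (-((n:ℝ) - 1)) = (denom n i₀ z ^ (-((n:ℝ) / 2))) ^ 2 * denom n i₀ z := by
    rw [← Real.rpow_natCast (_ ^ _), ← Real.rpow_mul hd.le, ← Real.rpow_add_one hd.ne']
    congr 1
    push_cast
    ring
  have e3 : denom n i₀ z ^ (-(n:ℝ)) = (denom n i₀ z ^ (-((n:ℝ) / 2))) ^ 2 := by
    rw [← Real.rpow_natCast (_ ^ _), ← Real.rpow_mul hd.le]
    congr 1
    push_cast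
    ring
  have e4 : denom n i₀ z ^ (-(((n:ℝ) - 2) / 2)) = denom n i₀ z ^ (-((n:ℝ) / 2)) * denom n i₀ z := by
    rw [← Real.rpow_add_one hd.ne']
    congr 1
    ring
  rw [e1, e2, e3, e4, Real.rpow_zero, Real.rpow_one, Real.rpow_two]
  ring

theorem stmt19 (n : ℕ) (hn : 5 ≤ n) :
    -- `ψ̂` is biharmonic in the upper half-space `{z_n > 0}`
    (∀ z : E n, 0 < z ⟨n - 1, by omega⟩ →
      lap n (lap n (psiHat n ⟨n - 1, by omega⟩)) z = 0) ∧
    -- boundary value `ψ̂(z',0) = (2/(1+|z'|²))^{(n-4)/2}`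
    (∀ z : E n, z ⟨n - 1, by omega⟩ = 0 →
      psiHat n ⟨n - 1, by omega⟩ z = (2 / (1 + ‖z‖ ^ 2)) ^ (((n:ℝ) - 4) / 2)) ∧
    -- `∂_{z_n} ψ̂ = 0` on the boundary
    (∀ z : E n, z ⟨n - 1, by omega⟩ = 0 →
      fderiv ℝ (psiHat n ⟨n - 1, by omega⟩) z (EuclideanSpace.single ⟨n - 1, by omega⟩ 1) = 0) ∧
    -- `∫_{ℝⁿ₊} (Δψ̂)² dz = (n(n-2)(n-4)/4) |S^{n-1}|`
    (∫ z in {z : E n | 0 < z ⟨n - 1, by omega⟩},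
        (lap n (psiHat n ⟨n - 1, by omega⟩) z) ^ 2) =
      ((n:ℝ) * ((n:ℝ) - 2) * ((n:ℝ) - 4) / 4) * SA n := by
  refine ⟨fun z hz => lap_lap_psi n _ z (denom_pos n _ z hz.le), fun z hz => ?_,
    fun z hz => bdry_deriv n _ z hz, int_final n hn _⟩
  simp [psiHat, denom, hz]
end
end
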